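/- arXiv:0906.2488 — 2 statements merged into one kernel-verified Lean document; each statement's English description precedes it below -/
import Mathlib

section
/- Let G be a finite simple graph on n vertices, let m ≥ 2 be even, let T be an m×n matrix over F₂ of rank m, let c ∈ F₂^m and z ∈ F₂. Suppose that for every x ∈ F₂^n, writing y = T·x + c, one has f_G(x) = y₁y₂ + y₃y₄ + … + y_{m-1}y_m + z (a readonce form of Type II). Then the binary rank of G equals m. -/
/-- The quadratic Boolean form associated with a graph `G`:
`f_G(x) = ∑_{{i,j} ∈ E(G)} x_i x_j` over `F₂ = ZMod 2`. -/
noncomputable def quadForm {V : Type*} [Fintype V] (G : SimpleGraph V)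
    (x : V → ZMod 2) : ZMod 2 := by
  classical
  exact ∑ e ∈ G.edgeFinset,
    Sym2.lift ⟨fun i j => x i * x j, fun a b => mul_comm (x a) (x b)⟩ e

/-- The MS-number `w(G)`: the number of `x ∈ F₂^V` with `f_G(x) = 1`. -/
noncomputable def msNumber {V : Type*} [Fintype V] (G : SimpleGraph V) : ℕ := by
  classical
  exact (Finset.univ.filter fun x : V → ZMod 2 => quadForm G x = 1).card

/-- The binary rank of a graph: the rank of its adjacency matrix over `F₂`. -/
noncomputable def brank {V : Type*} [Fintype V] [DecidableEq V]
    (G : SimpleGraph V) : ℕ := by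
  classical
  exact (SimpleGraph.adjMatrix (ZMod 2) G).rank

/-- Extend a vector indexed by `Fin m` to one indexed by `ℕ` (zero elsewhere). -/
def extendVec {m : ℕ} (v : Fin m → ZMod 2) : ℕ → ZMod 2 :=
  fun k => if h : k < m then v ⟨k, h⟩ else 0

/-- The readonce form of Type I in `m` variables (`m` odd), `0`-indexed:
`g(y) = y₁ + y₂y₃ + y₄y₅ + … + y_{m-1}y_m + z` (where `y₁,…,y_m` is `1`-indexed). -/
def typeI (m : ℕ) (y : ℕ → ZMod 2) (z : ZMod 2) : ZMod 2 :=
  y 0 + (∑ k ∈ Finset.range ((m - 1) / 2), y (2 * k + 1) * y (2 * k + 2)) + z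

/-- The readonce form of Type II in `m` variables (`m` even), `0`-indexed:
`g(y) = y₁y₂ + y₃y₄ + … + y_{m-1}y_m + z` (where `y₁,…,y_m` is `1`-indexed). -/
def typeII (m : ℕ) (y : ℕ → ZMod 2) (z : ZMod 2) : ZMod 2 :=
  (∑ k ∈ Finset.range (m / 2), y (2 * k) * y (2 * k + 1)) + z

/-- The polar form of the quadratic form of a graph is the bilinear form of its adjacency
matrix. -/
theorem quadForm_add {V : Type*} [Fintype V] (G : SimpleGraph V) [DecidableRel G.Adj]
    (x y : V → ZMod 2) :
    quadForm G (x + y) =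
      quadForm G x + quadForm G y + dotProduct ((G.adjMatrix (ZMod 2)).mulVec x) y := by
  classical
  have key : dotProduct ((G.adjMatrix (ZMod 2)).mulVec x) y =
      ∑ e ∈ G.edgeFinset, Sym2.lift ⟨fun i j => x i * y j + x j * y i,
        fun a b => add_comm _ _⟩ e := by
    calc dotProduct ((G.adjMatrix (ZMod 2)).mulVec x) y
        = ∑ p : V × V with G.Adj p.1 p.2, x p.2 * y p.1 := by
          simp [dotProduct, SimpleGraph.adjMatrix_mulVec_apply, Finset.sum_mul,
            Finset.sum_filter, Fintype.sum_prod_type, SimpleGraph.neighborFinset_eq_filter]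
      _ = ∑ d : G.Dart, x d.snd * y d.fst :=
          Finset.sum_bij' (fun p hp => ⟨p, (Finset.mem_filter.1 hp).2⟩) (fun d _ => d.toProd)
            (by simp) (by simp) (by simp) (by simp) (by simp)
      _ = ∑ e ∈ G.edgeFinset, ∑ d : G.Dart with d.edge = e, x d.snd * y d.fst :=
          (Finset.sum_fiberwise_of_maps_to
            (fun d _ => SimpleGraph.mem_edgeFinset.2 d.edge_mem) _).symm
      _ = _ := by
          refine Finset.sum_congr rfl fun e he => ?_
          obtain ⟨a, b⟩ := e
          let d : G.Dart := ⟨(a, b), SimpleGraph.mem_edgeFinset.1 he⟩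
          have hd : ({d' : G.Dart | d'.edge = s(a, b)} : Finset _) = {d, d.symm} := d.edge_fiber
          change ∑ d' : G.Dart with d'.edge = s(a, b), x d'.snd * y d'.fst = x a * y b + x b * y a
          rw [hd, Finset.sum_pair d.symm_ne.symm]
          exact add_comm _ _
  have hquad (w : V → ZMod 2) : quadForm G w =
      ∑ e ∈ G.edgeFinset, Sym2.lift ⟨fun i j => w i * w j, fun a b => mul_comm _ _⟩ e :=
    Finset.sum_congr (by congr!) fun _ _ => rfl
  rw [key, hquad, hquad, hquad, ← Finset.sum_add_distrib, ← Finset.sum_add_distrib]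
  refine Finset.sum_congr rfl fun e _ => ?_
  induction e with
  | _ a b =>
    simp only [Sym2.lift_mk, Pi.add_apply]
    ring

theorem extendVec_add {m : ℕ} (u v : Fin m → ZMod 2) :
    extendVec (u + v) = extendVec u + extendVec v := by
  funext k
  by_cases hk : k < m <;> simp [extendVec, hk]

theorem extendVec_zero {m : ℕ} : extendVec (0 : Fin m → ZMod 2) = 0 := by
  funext k
  simp [extendVec]

theorem extendVec_single {m : ℕ} (i : Fin m) (k : ℕ) :
    extendVec (Pi.single i 1) k = if k = i then 1 else 0 := by
  by_cases hk : k < m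
  · simp [extendVec, hk, Pi.single_apply, Fin.ext_iff]
  · have := i.isLt
    simp [extendVec, hk, show k ≠ i by lia]

/-- The polar form of the readonce form of Type II in `m` variables. -/
def typeIIPolar (m : ℕ) (u v : ℕ → ZMod 2) : ZMod 2 :=
  ∑ k ∈ Finset.range (m / 2), (u (2 * k) * v (2 * k + 1) + u (2 * k + 1) * v (2 * k))

theorem typeII_polar (m : ℕ) (u v c : ℕ → ZMod 2) (z : ZMod 2) :
    typeII m (u + v + c) z =
      typeII m (u + c) z + typeII m (v + c) z - typeII m c z + typeIIPolar m u v := by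
  have hsum : ∑ k ∈ Finset.range (m / 2), (u + v + c) (2 * k) * (u + v + c) (2 * k + 1) =
      ∑ k ∈ Finset.range (m / 2), ((u + c) (2 * k) * (u + c) (2 * k + 1) +
        (v + c) (2 * k) * (v + c) (2 * k + 1) - c (2 * k) * c (2 * k + 1) +
        (u (2 * k) * v (2 * k + 1) + u (2 * k + 1) * v (2 * k))) := by
    refine Finset.sum_congr rfl fun k _ => ?_
    simp only [Pi.add_apply]
    ring
  rw [Finset.sum_add_distrib, Finset.sum_sub_distrib, Finset.sum_add_distrib] at hsum
  simp only [typeII, typeIIPolar, hsum]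
  ring

/-- For even `m` the polar form of the readonce form of Type II is nondegenerate. -/
theorem eq_zero_of_typeIIPolar_eq_zero {m : ℕ} (heven : Even m) (u : Fin m → ZMod 2)
    (hu : ∀ v : Fin m → ZMod 2, typeIIPolar m (extendVec u) (extendVec v) = 0) : u = 0 := by
  funext i
  have hi := i.isLt
  have hui : extendVec u i = u i := by simp [extendVec]
  rw [Pi.zero_apply, ← hui]
  obtain ⟨r, hr⟩ := heven
  obtain ⟨k, hk⟩ := Nat.even_or_odd' (i : ℕ)
  have hkr : k ∈ Finset.range (m / 2) := Finset.mem_range.2 (by lia)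
  rcases hk with hk | hk
  · have h := hu (Pi.single ⟨2 * k + 1, by lia⟩ 1)
    simp only [typeIIPolar, extendVec_single] at h
    rw [Finset.sum_eq_single_of_mem k hkr] at h
    · simpa [hk] using h
    · intro j _ hj
      rw [if_neg (by lia), if_neg (by lia)]
      ring
  · have h := hu (Pi.single ⟨2 * k, by lia⟩ 1)
    simp only [typeIIPolar, extendVec_single] at h
    rw [Finset.sum_eq_single_of_mem k hkr] at h
    · simpa [hk] using h
    · intro j _ hj
      rw [if_neg (by lia), if_neg (by lia)]
      ring

/-- Matrices over a field with the same kernel have the same rank. -/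
theorem Matrix.rank_eq_of_mulVec_eq_zero_iff {l m n K : Type*} [Fintype l] [Fintype m] [Fintype n]
    [Field K] (A : Matrix l n K) (B : Matrix m n K)
    (h : ∀ x, A.mulVec x = 0 ↔ B.mulVec x = 0) : A.rank = B.rank := by
  have hker : A.mulVecLin.ker = B.mulVecLin.ker := by
    ext x
    simpa using h x
  have hA := A.mulVecLin.finrank_range_add_finrank_ker
  have hB := B.mulVecLin.finrank_range_add_finrank_ker
  rw [hker] at hA
  exact Nat.add_right_cancel (hA.trans hB.symm)

theorem Matrix.mulVec_surjective_of_rank_eq_card {m n K : Type*} [Fintype m] [Fintype n] [Field K]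
    (A : Matrix m n K) (h : A.rank = Fintype.card m) : Function.Surjective A.mulVec := by
  have : A.mulVecLin.range = ⊤ := by
    apply Submodule.eq_top_of_finrank_eq
    rw [Module.finrank_fintype_fun_eq_card]
    exact h
  exact LinearMap.range_eq_top.1 this

theorem brank_eq_of_typeII {n m : ℕ} (G : SimpleGraph (Fin n))
    (hm : 2 ≤ m) (heven : Even m)
    (T : Matrix (Fin m) (Fin n) (ZMod 2)) (hT : T.rank = m)
    (c : Fin m → ZMod 2) (z : ZMod 2)
    (h : ∀ x : Fin n → ZMod 2,
      quadForm G x = typeII m (extendVec (T.mulVec x + c)) z) :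
    brank G = m := by
  classical
  have hsurj := T.mulVec_surjective_of_rank_eq_card (by simpa using hT)
  have hquad_zero : quadForm G 0 = 0 := by
    have := quadForm_add G 0 0
    simpa using this
  have hpolar (x y : Fin n → ZMod 2) : dotProduct ((G.adjMatrix (ZMod 2)).mulVec x) y =
      typeIIPolar m (extendVec (T.mulVec x)) (extendVec (T.mulVec y)) := by
    have hadd := quadForm_add G x y
    have hzero := h 0
    rw [h, h, h, Matrix.mulVec_add] at hadd
    rw [hquad_zero, Matrix.mulVec_zero, zero_add] at hzero
    simp only [extendVec_add] at hadd
    rw [typeII_polar, ← hzero] at hadd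
    simpa using hadd.symm
  rw [brank, ← hT]
  refine Matrix.rank_eq_of_mulVec_eq_zero_iff _ _ fun x => ⟨fun hx => ?_, fun hx => ?_⟩
  · refine eq_zero_of_typeIIPolar_eq_zero heven _ fun v => ?_
    obtain ⟨y, rfl⟩ := hsurj v
    rw [← hpolar, hx, zero_dotProduct]
  · refine dotProduct_eq_zero _ fun y => ?_
    rw [hpolar, hx, extendVec_zero]
    simp [typeIIPolar]
end

section
/- Let n ≥ 4 and let G be any finite simple graph on n vertices. Then w(G) ≤ 2^{n-1} + 2^{n-3}. -/
/-- The nontrivial additive character of `ZMod 2`, with integer values. -/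
def signChar (t : ZMod 2) : ℤ := if t = 1 then -1 else 1

lemma signChar_add (s t : ZMod 2) : signChar (s + t) = signChar s * signChar t := by
  revert s t; decide

lemma abs_signChar (t : ZMod 2) : |signChar t| = 1 := by
  revert t; decide

namespace QuadraticMap

variable {M : Type*} [AddCommGroup M] [Module (ZMod 2) M] [Fintype M]

/-- The exponential sum of a quadratic form over `ZMod 2`. -/
def signSum (Q : QuadraticForm (ZMod 2) M) : ℤ := ∑ x, signChar (Q x)

lemma signSum_nonneg_of_polar_eq_zero (Q : QuadraticForm (ZMod 2) M)
    (h : ∀ x y, polar Q x y = 0) : 0 ≤ signSum Q := by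
  by_cases hQ : ∃ a, Q a = 1
  · obtain ⟨a, ha⟩ := hQ
    have key : signSum Q = -signSum Q := by
      calc signSum Q = ∑ x, signChar (Q (x + a)) :=
            (Equiv.sum_comp (Equiv.addRight a) fun x => signChar (Q x)).symm
        _ = ∑ x, -signChar (Q x) := by
            refine Finset.sum_congr rfl fun x _ => ?_
            rw [QuadraticMap.map_add Q, h, ha, add_zero, signChar_add]
            simp [signChar]
        _ = -signSum Q := by rw [Finset.sum_neg_distrib, signSum]
    omega
  · push Not at hQ
    exact Finset.sum_nonneg fun x _ => by simp [signChar, hQ x]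

/-- Averaging the exponential sum over the cosets of the span of a hyperbolic pair. -/
lemma four_mul_signSum (Q : QuadraticForm (ZMod 2) M) {a b : M} (hab : polar Q a b = 1) :
    4 * signSum Q = 2 * ∑ x, signChar
      (Q x + (Q a + polar Q x a) * (Q b + polar Q x b)) := by
  have shift (c : M) : ∑ x, signChar (Q (x + c)) = signSum Q :=
    Equiv.sum_comp (Equiv.addRight c) fun x => signChar (Q x)
  have hsum : 4 * signSum Q = ∑ x, (signChar (Q x) + signChar (Q (x + a)) +
      signChar (Q (x + b)) + signChar (Q (x + (a + b)))) := by
    simp only [Finset.sum_add_distrib, shift]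
    rw [← signSum]; ring
  rw [hsum, Finset.mul_sum]
  refine Finset.sum_congr rfl fun x _ => ?_
  simp only [QuadraticMap.map_add Q, polar_add_right, hab]
  generalize Q x = q, Q a = r, Q b = s, polar Q x a = t, polar Q x b = u
  revert q r s t u
  decide

lemma two_mul_abs_signSum_le (Q : QuadraticForm (ZMod 2) M) {a b : M}
    (hab : polar Q a b = 1) : 2 * |signSum Q| ≤ Fintype.card M := by
  have h := four_mul_signSum Q hab
  have hle : |2 * signSum Q| ≤ Fintype.card M := by
    rw [show 2 * signSum Q = _ by linarith]
    refine (Finset.abs_sum_le_sum_abs _ _).trans ?_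
    simp [abs_signChar]
  rwa [abs_mul, abs_two] at hle

/-- Projection onto the orthogonal complement of an isotropic hyperbolic pair. -/
lemma exists_two_mul_signSum_eq (Q : QuadraticForm (ZMod 2) M) {a b : M}
    (ha : Q a = 0) (hb : Q b = 0) (hab : polar Q a b = 1) :
    ∃ Q' : QuadraticForm (ZMod 2) M, 2 * signSum Q = signSum Q' := by
  let p : M →ₗ[ZMod 2] M := LinearMap.id + (Q.polarBilin b).smulRight a +
    (Q.polarBilin a).smulRight b
  refine ⟨Q.comp p, ?_⟩
  have hp (x : M) : Q.comp p x = Q x + (Q a + polar Q x a) * (Q b + polar Q x b) := by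
    simp only [p, QuadraticMap.comp_apply, LinearMap.add_apply, LinearMap.id_apply,
      LinearMap.smulRight_apply, polarBilin_apply_apply, QuadraticMap.map_add Q, polar_add_left,
      polar_smul_left, polar_smul_right, QuadraticMap.map_smul, ha, hb, hab, smul_eq_mul,
      polar_comm Q b x, polar_comm Q a x]
    generalize Q x = q, polar Q x a = t, polar Q x b = u
    revert q t u
    decide
  have h := four_mul_signSum Q hab
  simp only [signSum, hp] at h ⊢
  linarith

lemma neg_card_le_two_mul_signSum (Q : QuadraticForm (ZMod 2) M) :
    -(Fintype.card M : ℤ) ≤ 2 * signSum Q := by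
  by_cases h : ∀ x y, polar Q x y = 0
  · have := signSum_nonneg_of_polar_eq_zero Q h
    omega
  · push Not at h
    obtain ⟨a, b, hab⟩ := h
    have := two_mul_abs_signSum_le Q (Fin.eq_one_of_ne_zero _ hab)
    have := neg_abs_le (signSum Q)
    omega

/-- A quadratic form over `ZMod 2` vanishing on a basis has exponential sum at least
`-|M| / 4`. -/
lemma neg_card_le_four_mul_signSum {ι : Type*} (v : Module.Basis ι (ZMod 2) M)
    (Q : QuadraticForm (ZMod 2) M) (hv : ∀ i, Q (v i) = 0) :
    -(Fintype.card M : ℤ) ≤ 4 * signSum Q := by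
  by_cases h : ∀ i j, polar Q (v i) (v j) = 0
  · have hB : Q.polarBilin = 0 := v.ext fun i => v.ext fun j => by simpa using h i j
    have := signSum_nonneg_of_polar_eq_zero Q fun x y => by
      simpa using LinearMap.congr_fun₂ hB x y
    omega
  · push Not at h
    obtain ⟨i, j, hij⟩ := h
    obtain ⟨Q', hQ'⟩ := exists_two_mul_signSum_eq Q (hv i) (hv j) (Fin.eq_one_of_ne_zero _ hij)
    have := neg_card_le_two_mul_signSum Q'
    omega

end QuadraticMap

namespace SimpleGraph

variable {V : Type*} [Fintype V] (G : SimpleGraph V)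

lemma exists_quadraticForm_eq_quadForm :
    ∃ Q : QuadraticForm (ZMod 2) (V → ZMod 2), ∀ x, Q x = quadForm G x := by
  classical
  refine ⟨∑ e ∈ G.edgeFinset, Sym2.lift ⟨fun i j => QuadraticMap.linMulLin
    (LinearMap.proj (R := ZMod 2) (φ := fun _ : V => ZMod 2) i) (LinearMap.proj j),
    fun i j => by ext x; simp [mul_comm]⟩ e, fun x => ?_⟩
  rw [sum_apply, quadForm]
  refine Finset.sum_congr (by congr) fun e _ => ?_
  induction e with
  | _ i j => simp

lemma quadForm_single [DecidableEq V] (i : V) :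
    quadForm G (Pi.single i 1) = 0 := by
  rw [quadForm]
  refine Finset.sum_eq_zero fun e he => ?_
  induction e with
  | _ j k =>
    have hjk : j ≠ k := G.ne_of_adj (by simpa using he)
    rcases eq_or_ne j i with rfl | hj
    · simp [hjk.symm]
    · simp [hj]

lemma eight_mul_msNumber_le : 8 * msNumber G ≤ 5 * 2 ^ Fintype.card V := by
  classical
  obtain ⟨Q, hQ⟩ := exists_quadraticForm_eq_quadForm G
  have h := QuadraticMap.neg_card_le_four_mul_signSum (Pi.basisFun (ZMod 2) V) Q fun i => by
    rw [Pi.basisFun_apply, hQ, quadForm_single]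
  have hS : QuadraticMap.signSum Q = 2 ^ Fintype.card V - 2 * (msNumber G : ℤ) := by
    have hχ (t : ZMod 2) : signChar t = 1 - 2 * if t = 1 then 1 else 0 := by
      revert t; decide
    simp only [QuadraticMap.signSum, hQ, hχ, Finset.sum_sub_distrib, ← Finset.mul_sum,
      Finset.sum_boole, msNumber]
    simp
  have hc : (Fintype.card (V → ZMod 2) : ℤ) = 2 ^ Fintype.card V := by simp
  rw [hS, hc] at h
  zify
  linarith

end SimpleGraph

theorem msNumber_upper_bound {n : ℕ} (hn : 4 ≤ n) (G : SimpleGraph (Fin n)) :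
    msNumber G ≤ 2 ^ (n - 1) + 2 ^ (n - 3) := by
  have h := G.eight_mul_msNumber_le
  rw [Fintype.card_fin, ← pow_sub_mul_pow 2 (show 3 ≤ n by omega)] at h
  rw [show n - 1 = n - 3 + 2 by omega, pow_add]
  omega
end
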